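/- (Hardy-type estimate with gradient term.) Suppose h satisfies the uniform ellipticity bounds with constants ν, N, and suppose there are σ'∈(0,1) and C_R ≥ 0 such that |R_h(x)| ≤ C_R ⟨x⟩^{−(1+σ')}|x|^{−1} for all x≠0. There are constants c = c(ν,N) > 0 and c' = c'(ν,N) > 0, depending only on ν and N, such that if C_R < c then for every ε∈(0,1), every m ≥ 0, every operator H as in the context, and every compactly supported smooth f:ℝ³→ℂ⁴, one has m² ∫_{M_h} |f|² + ((1−ε)c − C_R) ∫_{M_h} |f(x)|²/|x|² + ε c' ∫_{M_h} |∇f|² ≤ ∫_{M_h} |Hf|², where ∇f is the Euclidean gradient. -/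

import Mathlib

noncomputable section
open MeasureTheory Real Set

abbrev Eu (n : ℕ) : Type := EuclideanSpace ℝ (Fin n)

def pd {n : ℕ} {F : Type*} [NormedAddCommGroup F] [NormedSpace ℝ F]
    (j : Fin n) (f : Eu n → F) (x : Eu n) : F :=
  fderiv ℝ f x (EuclideanSpace.single j 1)

def Chr {n : ℕ} (h : Eu n → Matrix (Fin n) (Fin n) ℝ) (i j k : Fin n) (x : Eu n) : ℝ :=
  (1/2) * ∑ l, (h x)⁻¹ i l *
    (pd j (fun y => h y l k) x + pd k (fun y => h y j l) x - pd l (fun y => h y j k) x)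

def Rscal {n : ℕ} (h : Eu n → Matrix (Fin n) (Fin n) ℝ) (x : Eu n) : ℝ :=
  ∑ j, ∑ k, (h x)⁻¹ j k *
    ((∑ i, pd i (fun y => Chr h i j k y) x) - (∑ i, pd k (fun y => Chr h i j i y) x)
      + (∑ i, ∑ l, Chr h l j k x * Chr h i i l x) - (∑ i, ∑ l, Chr h l j i x * Chr h i k l x))

def sdet {n : ℕ} (h : Eu n → Matrix (Fin n) (Fin n) ℝ) (x : Eu n) : ℝ := Real.sqrt (h x).det

def lapR {n : ℕ} (h : Eu n → Matrix (Fin n) (Fin n) ℝ) (f : Eu n → ℝ) (x : Eu n) : ℝ :=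
  (sdet h x)⁻¹ * ∑ j, pd j (fun y => sdet h y * ∑ k, (h y)⁻¹ j k * pd k f y) x

def lapC {n : ℕ} (h : Eu n → Matrix (Fin n) (Fin n) ℝ) (f : Eu n → ℂ) (x : Eu n) : ℂ :=
  ((sdet h x : ℝ) : ℂ)⁻¹ *
    ∑ j, pd j (fun y => ((sdet h y : ℝ) : ℂ) * ∑ k, (((h y)⁻¹ j k : ℝ) : ℂ) * pd k f y) x

def jap {n : ℕ} (x : Eu n) : ℝ := Real.sqrt (1 + ‖x‖ ^ 2)

def Hop (A : Fin 3 → Eu 3 → Fin 4 → Fin 4 → ℂ) (B : Eu 3 → Fin 4 → Fin 4 → ℂ)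
    (f : Eu 3 → Fin 4 → ℂ) (x : Eu 3) : Fin 4 → ℂ :=
  fun i => (∑ j, ∑ k, A j x i k * pd j f x k) + ∑ k, B x i k * f x k

def Elliptic (h : Eu 3 → Matrix (Fin 3) (Fin 3) ℝ) (ν N : ℝ) : Prop :=
  ∀ x : Eu 3, ∀ ξ : Fin 3 → ℝ,
    ν * (∑ j, ξ j ^ 2) ≤ (∑ j, ∑ k, (h x)⁻¹ j k * ξ j * ξ k) ∧
      (∑ j, ∑ k, (h x)⁻¹ j k * ξ j * ξ k) ≤ N * (∑ j, ξ j ^ 2)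

def opNorm {n : ℕ} (A : Matrix (Fin n) (Fin n) ℝ) : ℝ :=
  ‖LinearMap.toContinuousLinearMap (Matrix.toEuclideanLin A)‖

def pdM {n : ℕ} (j : Fin n) (H : Eu n → Matrix (Fin n) (Fin n) ℝ) (x : Eu n) :
    Matrix (Fin n) (Fin n) ℝ :=
  Matrix.of fun a b => pd j (fun y => H y a b) x

def AFlat (h : Eu 3 → Matrix (Fin 3) (Fin 3) ℝ) (σ CI Ch : ℝ) : Prop :=
  (∀ x : Eu 3, opNorm ((h x)⁻¹ - 1) ≤ CI * jap x ^ (-σ)) ∧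
  (∀ x : Eu 3,
    (∑ j, opNorm (pdM j (fun y => (h y)⁻¹) x))
      + ‖x‖ * (∑ j, ∑ k, opNorm (pdM j (pdM k (fun y => (h y)⁻¹)) x))
      + ‖x‖ ^ 2 * (∑ j, ∑ k, ∑ l, opNorm (pdM j (pdM k (pdM l (fun y => (h y)⁻¹))) x))
    ≤ Ch * jap x ^ (-(1 + σ)))

def sphInt (f : Eu 3 → ℝ) (R : ℝ) : ℝ :=
  R ^ 2 * ∫ ω : Metric.sphere (0 : Eu 3) 1, f (R • (ω : Eu 3)) ∂(volume.toSphere)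

def innC4 (h : Eu 3 → Matrix (Fin 3) (Fin 3) ℝ) (f g : Eu 3 → Fin 4 → ℂ) : ℂ :=
  ∫ x : Eu 3, (∑ i, (starRingEnd ℂ) (f x i) * g x i) * ((sdet h x : ℝ) : ℂ)

section Divergence

variable {n : ℕ} {F : Type*} [NormedAddCommGroup F]

lemma pd_of_notMem_tsupport [NormedSpace ℝ F] {f : Eu n → F} {x : Eu n} (hx : x ∉ tsupport f)
    (j : Fin n) : pd j f x = 0 := by
  simp [pd, fderiv_of_notMem_tsupport ℝ hx]

lemma HasCompactSupport.pd [NormedSpace ℝ F] {f : Eu n → F} (hf : HasCompactSupport f)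
    (j : Fin n) : HasCompactSupport (pd j f) :=
  HasCompactSupport.intro hf fun _ hx => pd_of_notMem_tsupport hx j

lemma ContDiff.pd [NormedSpace ℝ F] {f : Eu n → F} {k m : WithTop ℕ∞} (hf : ContDiff ℝ m f)
    (hk : k + 1 ≤ m) (j : Fin n) : ContDiff ℝ k (pd j f) :=
  (hf.fderiv_right hk).clm_apply contDiff_const

lemma ContDiff.continuous_pd [NormedSpace ℝ F] {f : Eu n → F} (hf : ContDiff ℝ 1 f)
    (j : Fin n) : Continuous (_root_.pd j f) :=
  (hf.pd (k := 0) (by simp) j).continuous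

lemma ContDiff.integrable_pd [NormedSpace ℝ F] {f : Eu n → F} (hf : ContDiff ℝ 1 f)
    (hc : HasCompactSupport f) (j : Fin n) : Integrable (_root_.pd j f) :=
  (hf.continuous_pd j).integrable_of_hasCompactSupport (hc.pd j)

lemma integral_pd_eq_zero [NormedSpace ℝ F] {f : Eu n → F} (hf : ContDiff ℝ 1 f)
    (hc : HasCompactSupport f) (j : Fin n) : ∫ x, pd j f x = 0 := by
  have h := integral_smul_fderiv_eq_neg_fderiv_smul_of_integrable (μ := (volume : Measure (Eu n)))
    (f := fun _ : Eu n => (1 : ℝ)) (g := f) (v := EuclideanSpace.single j 1)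
    (by simp) (by simpa using! hf.integrable_pd hc j)
    (by simpa using hf.continuous.integrable_of_hasCompactSupport hc)
    (fun _ _ => by fun_prop) (fun x _ => (hf.differentiable (by simp)) x)
  simpa using! h

lemma ContDiff.integrable_norm_sq_pd [NormedSpace ℝ F] {f : Eu n → F} (hf : ContDiff ℝ 1 f)
    (hc : HasCompactSupport f) (j : Fin n) : Integrable fun x => ‖_root_.pd j f x‖ ^ 2 := by
  have h : HasCompactSupport fun x => ‖_root_.pd j f x‖ ^ 2 :=
    HasCompactSupport.intro hc fun x hx => by simp [pd_of_notMem_tsupport hx j]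
  exact ((hf.continuous_pd j).norm.pow 2).integrable_of_hasCompactSupport h

lemma pd_hardyField [InnerProductSpace ℝ F] {u : Eu n → F} (hu : ContDiff ℝ 1 u) {δ : ℝ}
    (hδ : 0 < δ) (j : Fin n) (x : Eu n) :
    pd j (fun y : Eu n => y j * (‖y‖ ^ 2 + δ)⁻¹ * ‖u y‖ ^ 2) x =
      (‖x‖ ^ 2 + δ)⁻¹ * ‖u x‖ ^ 2 - 2 * x j ^ 2 * (‖x‖ ^ 2 + δ)⁻¹ ^ 2 * ‖u x‖ ^ 2
        + 2 * x j * (‖x‖ ^ 2 + δ)⁻¹ * inner ℝ (u x) (pd j u x) := by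
  have h1 : HasFDerivAt (fun y : Eu n => y j) (EuclideanSpace.proj j : Eu n →L[ℝ] ℝ) x :=
    (EuclideanSpace.proj j : Eu n →L[ℝ] ℝ).hasFDerivAt
  have h2 := ((hasFDerivAt_id (𝕜 := ℝ) x).norm_sq.add_const δ)
  have hq : ‖x‖ ^ 2 + δ ≠ 0 := by positivity
  have h3 := (hasDerivAt_inv hq).comp_hasFDerivAt x h2
  have h4 := ((hu.differentiable (by simp)) x).hasFDerivAt.norm_sq
  have h5 := (h1.mul h3).mul h4
  unfold pd
  rw [HasFDerivAt.fderiv (by simpa using! h5)]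
  simp [EuclideanSpace.inner_single_right]
  field_simp
  ring

lemma hardy_pointwise [InnerProductSpace ℝ F] {u : Eu 3 → F} (hu : ContDiff ℝ 1 u) {δ : ℝ}
    (hδ : 0 < δ) (x : Eu 3) :
    ‖u x‖ ^ 2 * (‖x‖ ^ 2 + δ)⁻¹ ≤ 4 * ∑ j, ‖pd j u x‖ ^ 2
      + 2 * ∑ j, pd j (fun y : Eu 3 => y j * (‖y‖ ^ 2 + δ)⁻¹ * ‖u y‖ ^ 2) x := by
  have hq : 0 < ‖x‖ ^ 2 + δ := by positivity
  have hsq : ∀ j, 0 ≤ 4 * ‖pd j u x‖ ^ 2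
      + 4 * x j * (‖x‖ ^ 2 + δ)⁻¹ * inner ℝ (u x) (pd j u x)
      + x j ^ 2 * (‖x‖ ^ 2 + δ)⁻¹ ^ 2 * ‖u x‖ ^ 2 := fun j => by
    have := sq_nonneg ‖(2 : ℝ) • pd j u x + (x j * (‖x‖ ^ 2 + δ)⁻¹) • u x‖
    rw [norm_add_sq_real, norm_smul, norm_smul, inner_smul_left, inner_smul_right, mul_pow,
      mul_pow, Real.norm_eq_abs, Real.norm_eq_abs, sq_abs, sq_abs, real_inner_comm] at this
    simp only [conj_trivial] at this
    linarith
  have hx : ‖x‖ ^ 2 = x 0 ^ 2 + x 1 ^ 2 + x 2 ^ 2 := by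
    rw [EuclideanSpace.real_norm_sq_eq, Fin.sum_univ_three]
  have hle : ‖x‖ ^ 2 * (‖x‖ ^ 2 + δ)⁻¹ ^ 2 ≤ (‖x‖ ^ 2 + δ)⁻¹ := by
    have h1 : ‖x‖ ^ 2 * (‖x‖ ^ 2 + δ)⁻¹ ≤ 1 := by
      rw [← div_eq_mul_inv, div_le_one hq]; linarith
    have h2 : 0 ≤ (‖x‖ ^ 2 + δ)⁻¹ := (inv_pos.2 hq).le
    nlinarith
  have hle' := mul_le_mul_of_nonneg_right hle (sq_nonneg ‖u x‖)
  have h0 := hsq 0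
  have h1 := hsq 1
  have h2 := hsq 2
  simp only [pd_hardyField hu hδ, Fin.sum_univ_three]
  rw [mul_assoc, hx] at hle'
  rw [hx] at h0 h1 h2 ⊢
  generalize (x 0 ^ 2 + x 1 ^ 2 + x 2 ^ 2 + δ)⁻¹ = q at h0 h1 h2 hle' ⊢
  linarith

lemma hardy_regularized [InnerProductSpace ℝ F] {u : Eu 3 → F} (hu : ContDiff ℝ 1 u)
    (hc : HasCompactSupport u) {δ : ℝ} (hδ : 0 < δ) :
    ∫ x, ‖u x‖ ^ 2 * (‖x‖ ^ 2 + δ)⁻¹ ≤ 4 * ∫ x, ∑ j, ‖pd j u x‖ ^ 2 := by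
  have hinv : ContDiff ℝ 1 fun y : Eu 3 => (‖y‖ ^ 2 + δ)⁻¹ :=
    ((contDiff_norm_sq ℝ).add contDiff_const).inv fun x =>
      (add_pos_of_nonneg_of_pos (sq_nonneg ‖x‖) hδ).ne'
  have hwc : HasCompactSupport fun y => ‖u y‖ ^ 2 :=
    hc.comp_left (g := fun z : F => ‖z‖ ^ 2) (by simp)
  have hφd : ∀ j, ContDiff ℝ 1 fun y : Eu 3 => y j * (‖y‖ ^ 2 + δ)⁻¹ * ‖u y‖ ^ 2 := fun j =>
    ((EuclideanSpace.proj j : Eu 3 →L[ℝ] ℝ).contDiff.mul hinv).mul (hu.norm_sq ℝ)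
  have hφc : ∀ j, HasCompactSupport fun y : Eu 3 => y j * (‖y‖ ^ 2 + δ)⁻¹ * ‖u y‖ ^ 2 :=
    fun j => hwc.mul_left
  have hG : Integrable fun x => 4 * ∑ j, ‖pd j u x‖ ^ 2 :=
    (integrable_finsetSum _ fun j _ => hu.integrable_norm_sq_pd hc j).const_mul 4
  have hφi := fun j => (hφd j).integrable_pd (hφc j) j
  have hφ0 := fun j => integral_pd_eq_zero (hφd j) (hφc j) j
  have hS := (integrable_finsetSum Finset.univ fun j _ => hφi j).const_mul 2
  have key := integral_mono (((hu.continuous.norm.pow 2).mul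
      hinv.continuous).integrable_of_hasCompactSupport hwc.mul_right) (hG.add hS)
      (hardy_pointwise hu hδ)
  have hsplit := integral_add hG hS
  rw [integral_const_mul, integral_const_mul, integral_finsetSum _ fun j _ => hφi j,
    Finset.sum_eq_zero fun j _ => hφ0 j, mul_zero, add_zero] at hsplit
  exact key.trans hsplit.le

lemma lintegral_hardy [InnerProductSpace ℝ F] {u : Eu 3 → F} (hu : ContDiff ℝ 1 u)
    (hc : HasCompactSupport u) :
    ∫⁻ x, ENNReal.ofReal (‖u x‖ ^ 2 * (‖x‖ ^ 2)⁻¹) ≤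
      ENNReal.ofReal (4 * ∫ x, ∑ j, ‖pd j u x‖ ^ 2) := by
  let g : ℕ → Eu 3 → ℝ := fun k x => ‖u x‖ ^ 2 * (‖x‖ ^ 2 + 1 / ((k : ℝ) + 1))⁻¹
  have hδ : ∀ k : ℕ, (0 : ℝ) < 1 / ((k : ℝ) + 1) := fun k => by positivity
  have hgc : ∀ k, Continuous (g k) := fun k => (hu.continuous.norm.pow 2).mul
    (((continuous_norm.pow 2).add continuous_const).inv₀ fun x =>
      (add_pos_of_nonneg_of_pos (sq_nonneg ‖x‖) (hδ k)).ne')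
  have hgi : ∀ k, Integrable (g k) := fun k => (hgc k).integrable_of_hasCompactSupport
    (hc.comp_left (g := fun z : F => ‖z‖ ^ 2) (by simp)).mul_right
  calc ∫⁻ x, ENNReal.ofReal (‖u x‖ ^ 2 * (‖x‖ ^ 2)⁻¹)
      = ∫⁻ x, Filter.liminf (fun k => ENNReal.ofReal (g k x)) Filter.atTop := by
        refine lintegral_congr_ae ?_
        filter_upwards [Measure.ae_ne volume (0 : Eu 3)] with x hx
        have hx2 : ‖x‖ ^ 2 ≠ 0 := by simpa using hx
        have ht : Filter.Tendsto (fun k : ℕ => ‖x‖ ^ 2 + 1 / ((k : ℝ) + 1)) Filter.atTop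
            (nhds (‖x‖ ^ 2)) := by
          simpa using tendsto_one_div_add_atTop_nhds_zero_nat.const_add (‖x‖ ^ 2)
        exact (ENNReal.tendsto_ofReal ((ht.inv₀ hx2).const_mul (‖u x‖ ^ 2))).liminf_eq.symm
    _ ≤ Filter.liminf (fun k => ∫⁻ x, ENNReal.ofReal (g k x)) Filter.atTop :=
        lintegral_liminf_le fun k => (hgc k).measurable.ennreal_ofReal
    _ ≤ _ := by
        refine Filter.liminf_le_of_le (by isBoundedDefault) fun b hb => ?_
        obtain ⟨k, hk⟩ := hb.exists
        refine hk.trans ?_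
        rw [← ofReal_integral_eq_lintegral_ofReal (hgi k)
          (ae_of_all _ fun x => by
            have := hδ k
            change 0 ≤ ‖u x‖ ^ 2 * (‖x‖ ^ 2 + 1 / ((k : ℝ) + 1))⁻¹
            positivity)]
        exact ENNReal.ofReal_le_ofReal (hardy_regularized hu hc (hδ k))

lemma integrable_hardy [InnerProductSpace ℝ F] {u : Eu 3 → F} (hu : ContDiff ℝ 1 u)
    (hc : HasCompactSupport u) : Integrable fun x => ‖u x‖ ^ 2 * (‖x‖ ^ 2)⁻¹ := by
  have hm : AEStronglyMeasurable (fun x => ‖u x‖ ^ 2 * (‖x‖ ^ 2)⁻¹) volume :=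
    ((hu.continuous.norm.pow 2).aestronglyMeasurable.mul
      (by fun_prop : Measurable fun x : Eu 3 => (‖x‖ ^ 2)⁻¹).aestronglyMeasurable)
  refine ⟨hm, ?_⟩
  rw [hasFiniteIntegral_iff_ofReal (ae_of_all _ fun x => by positivity)]
  exact (lintegral_hardy hu hc).trans_lt ENNReal.ofReal_lt_top

/-- The Hardy inequality in dimension three. -/
lemma integral_hardy [InnerProductSpace ℝ F] {u : Eu 3 → F} (hu : ContDiff ℝ 1 u)
    (hc : HasCompactSupport u) :
    ∫ x, ‖u x‖ ^ 2 * (‖x‖ ^ 2)⁻¹ ≤ 4 * ∫ x, ∑ j, ‖pd j u x‖ ^ 2 := by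
  rw [integral_eq_lintegral_of_nonneg_ae (ae_of_all _ fun x => by positivity)
    (integrable_hardy hu hc).aestronglyMeasurable]
  refine ENNReal.toReal_le_of_le_ofReal ?_ (lintegral_hardy hu hc)
  exact mul_nonneg (by norm_num) (integral_nonneg fun x => Finset.sum_nonneg fun j _ => sq_nonneg _)

end Divergence

section Metric

open Matrix

lemma Elliptic.inv_det_bounds {h : Eu 3 → Matrix (Fin 3) (Fin 3) ℝ} {ν N : ℝ} (hν : 0 < ν)
    (hE : Elliptic h ν N) {x : Eu 3} (hx : (h x).PosDef) :
    ν ^ 3 ≤ (h x)⁻¹.det ∧ (h x)⁻¹.det ≤ N ^ 3 := by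
  have hA : ((h x)⁻¹).IsHermitian := hx.isHermitian.inv
  have hev : ∀ i, ν ≤ hA.eigenvalues i ∧ hA.eigenvalues i ≤ N := fun i => by
    have h1 := hA.eigenvalues_eq i
    have h2 : ∑ j, (hA.eigenvectorBasis i) j ^ 2 = 1 := by
      rw [← EuclideanSpace.real_norm_sq_eq, hA.eigenvectorBasis.orthonormal.1 i]; norm_num
    have h3 := hE x (hA.eigenvectorBasis i)
    rw [h2, mul_one, mul_one] at h3
    have h4 : hA.eigenvalues i = ∑ j, ∑ k, (h x)⁻¹ j k * (hA.eigenvectorBasis i) j *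
        (hA.eigenvectorBasis i) k := by
      rw [h1]
      simp only [dotProduct, mulVec, Finset.mul_sum, star_trivial, RCLike.re_to_real]
      exact Finset.sum_congr rfl fun j _ => Finset.sum_congr rfl fun k _ => by ring
    rw [h4]
    exact h3
  rw [hA.det_eq_prod_eigenvalues]
  constructor
  · calc ν ^ 3 = ∏ _i : Fin 3, ν := by simp
      _ ≤ _ := Finset.prod_le_prod (fun _ _ => hν.le) fun i _ => (hev i).1
  · calc _ ≤ ∏ _i : Fin 3, N :=
        Finset.prod_le_prod (fun i _ => hν.le.trans (hev i).1) fun i _ => (hev i).2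
      _ = N ^ 3 := by simp

lemma Elliptic.sdet_bounds {h : Eu 3 → Matrix (Fin 3) (Fin 3) ℝ} {ν N : ℝ} (hν : 0 < ν)
    (hE : Elliptic h ν N) {x : Eu 3} (hx : (h x).PosDef) :
    √((N ^ 3)⁻¹) ≤ sdet h x ∧ sdet h x ≤ √((ν ^ 3)⁻¹) := by
  obtain ⟨h1, h2⟩ := hE.inv_det_bounds hν hx
  have hd : (h x)⁻¹.det = ((h x).det)⁻¹ := by
    rw [det_nonsing_inv, Ring.inverse_eq_inv]
  rw [hd] at h1 h2
  have hp := hx.det_pos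
  exact ⟨Real.sqrt_le_sqrt ((inv_le_comm₀ (by positivity) (lt_of_lt_of_le (by positivity)
      (h1.trans h2))).1 h2),
    Real.sqrt_le_sqrt ((le_inv_comm₀ (by positivity) hp).1 h1)⟩

variable {n : ℕ} {h : Eu n → Matrix (Fin n) (Fin n) ℝ}

lemma contDiff_det {k : WithTop ℕ∞} (hs : ∀ i j, ContDiff ℝ k fun x => h x i j) :
    ContDiff ℝ k fun x => (h x).det := by
  simp only [det_apply]
  exact ContDiff.sum fun σ _ => (contDiff_prod fun i _ => hs _ _).const_smul _

lemma contDiff_sdet {k : WithTop ℕ∞} (hs : ∀ i j, ContDiff ℝ k fun x => h x i j)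
    (hp : ∀ x, (h x).PosDef) : ContDiff ℝ k (sdet h) :=
  (contDiff_det hs).sqrt fun x => (hp x).det_pos.ne'

lemma contDiff_inv_apply {k : WithTop ℕ∞} (hs : ∀ i j, ContDiff ℝ k fun x => h x i j)
    (hp : ∀ x, (h x).PosDef) (i j : Fin n) : ContDiff ℝ k fun x => (h x)⁻¹ i j := by
  have : (fun x => (h x)⁻¹ i j) =
      fun x => ((h x).det)⁻¹ * ((h x).updateRow j (Pi.single i 1)).det := by
    funext x
    rw [inv_def, Matrix.smul_apply, adjugate_apply, Ring.inverse_eq_inv, smul_eq_mul]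
  rw [this]
  refine ((contDiff_det hs).inv fun x => (hp x).det_pos.ne').mul (contDiff_det fun a b => ?_)
  by_cases hj : a = j
  · subst hj
    simpa using contDiff_const
  · simpa [updateRow_ne hj] using hs a b

lemma Elliptic.le_re_quadratic {h : Eu 3 → Matrix (Fin 3) (Fin 3) ℝ} {ν N : ℝ}
    (hE : Elliptic h ν N) (x : Eu 3) (z : Fin 3 → ℂ) :
    ν * ∑ j, ‖z j‖ ^ 2 ≤
      (∑ j, (starRingEnd ℂ) (z j) * ∑ k, (((h x)⁻¹ j k : ℝ) : ℂ) * z k).re := by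
  have h1 := (hE x fun j => (z j).re).1
  have h2 := (hE x fun j => (z j).im).1
  have h3 : ∀ j, ‖z j‖ ^ 2 = (z j).re ^ 2 + (z j).im ^ 2 := fun j => by
    rw [← Complex.normSq_eq_norm_sq, Complex.normSq_apply]; ring
  have h4 : (∑ j, (starRingEnd ℂ) (z j) * ∑ k, (((h x)⁻¹ j k : ℝ) : ℂ) * z k).re =
      (∑ j, ∑ k, (h x)⁻¹ j k * (z j).re * (z k).re)
        + ∑ j, ∑ k, (h x)⁻¹ j k * (z j).im * (z k).im := by
    simp only [Finset.mul_sum, Complex.re_sum, ← Finset.sum_add_distrib]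
    refine Finset.sum_congr rfl fun j _ => Finset.sum_congr rfl fun k _ => ?_
    simp
    ring
  rw [h4]
  simp only [h3, Finset.sum_add_distrib, mul_add]
  exact add_le_add h1 h2

end Metric

section Green

variable {n : ℕ} {h : Eu n → Matrix (Fin n) (Fin n) ℝ} {u : Eu n → ℂ}

lemma pd_conj_mul {v : Eu n → ℂ} {x : Eu n} (hu : DifferentiableAt ℝ u x)
    (hv : DifferentiableAt ℝ v x) (j : Fin n) :
    pd j (fun y => (starRingEnd ℂ) (u y) * v y) x =
      (starRingEnd ℂ) (u x) * pd j v x + (starRingEnd ℂ) (pd j u x) * v x := by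
  have h1 : HasFDerivAt (fun y => (starRingEnd ℂ) (u y))
      ((Complex.conjCLE : ℂ →L[ℝ] ℂ).comp (fderiv ℝ u x)) x :=
    (Complex.conjCLE : ℂ →L[ℝ] ℂ).hasFDerivAt.comp x hu.hasFDerivAt
  unfold pd
  rw [show fderiv ℝ (fun y => (starRingEnd ℂ) (u y) * v y) x = _ from
    (h1.mul hv.hasFDerivAt).fderiv]
  simp
  ring

lemma contDiff_flux (hs : ∀ i j, ContDiff ℝ (⊤ : ℕ∞) fun x => h x i j)
    (hp : ∀ x, (h x).PosDef) (hu : ContDiff ℝ (⊤ : ℕ∞) u) (j : Fin n) :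
    ContDiff ℝ (⊤ : ℕ∞)
      fun y => ((sdet h y : ℝ) : ℂ) * ∑ k, (((h y)⁻¹ j k : ℝ) : ℂ) * pd k u y :=
  (Complex.ofRealCLM.contDiff.comp (contDiff_sdet hs hp)).mul (ContDiff.sum fun k _ =>
    (Complex.ofRealCLM.contDiff.comp (contDiff_inv_apply hs hp j k)).mul (hu.pd (by simp) k))

lemma lapC_mul_sdet (hp : ∀ x, (h x).PosDef) (x : Eu n) :
    lapC h u x * ((sdet h x : ℝ) : ℂ) =
      ∑ j, pd j (fun y => ((sdet h y : ℝ) : ℂ) * ∑ k, (((h y)⁻¹ j k : ℝ) : ℂ) * pd k u y) x := by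
  have : ((sdet h x : ℝ) : ℂ) ≠ 0 := by
    exact_mod_cast (Real.sqrt_pos.2 (hp x).det_pos).ne'
  rw [lapC]
  field_simp

lemma integrable_conj_mul_lapC (hs : ∀ i j, ContDiff ℝ (⊤ : ℕ∞) fun x => h x i j)
    (hp : ∀ x, (h x).PosDef) (hu : ContDiff ℝ (⊤ : ℕ∞) u) (hc : HasCompactSupport u) :
    Integrable fun x => (starRingEnd ℂ) (u x) * (lapC h u x * ((sdet h x : ℝ) : ℂ)) := by
  simp only [lapC_mul_sdet hp]
  refine Continuous.integrable_of_hasCompactSupport ?_ ?_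
  · exact (Complex.continuous_conj.comp hu.continuous).mul (continuous_finsetSum _ fun j _ =>
      ((contDiff_flux hs hp hu j).of_le (by simp)).continuous_pd j)
  · exact HasCompactSupport.intro hc fun x hx => by simp [image_eq_zero_of_notMem_tsupport hx]

lemma integrable_norm_sq_pd_mul_sdet (hs : ∀ i j, ContDiff ℝ (⊤ : ℕ∞) fun x => h x i j)
    (hp : ∀ x, (h x).PosDef) (hu : ContDiff ℝ (⊤ : ℕ∞) u) (hc : HasCompactSupport u) (j : Fin n) :
    Integrable fun x => ‖pd j u x‖ ^ 2 * sdet h x := by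
  refine Continuous.integrable_of_hasCompactSupport ?_ ?_
  · exact (((hu.of_le (by simp)).continuous_pd j).norm.pow 2).mul
      (contDiff_sdet hs hp).continuous
  · exact HasCompactSupport.intro hc fun x hx => by simp [pd_of_notMem_tsupport hx j]

end Green

lemma Elliptic.integral_lapC_le {h : Eu 3 → Matrix (Fin 3) (Fin 3) ℝ} {u : Eu 3 → ℂ} {ν N : ℝ}
    (hE : Elliptic h ν N) (hs : ∀ i j, ContDiff ℝ (⊤ : ℕ∞) fun x => h x i j)
    (hp : ∀ x, (h x).PosDef) (hu : ContDiff ℝ (⊤ : ℕ∞) u) (hc : HasCompactSupport u) :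
    ∫ x, ((starRingEnd ℂ) (u x) * (lapC h u x * ((sdet h x : ℝ) : ℂ))).re ≤
      -(ν * ∫ x, ∑ j, ‖pd j u x‖ ^ 2 * sdet h x) := by
  let V : Fin 3 → Eu 3 → ℂ := fun j y =>
    ((sdet h y : ℝ) : ℂ) * ∑ k, (((h y)⁻¹ j k : ℝ) : ℂ) * pd k u y
  have hV : ∀ j, ContDiff ℝ 1 (V j) := fun j => (contDiff_flux hs hp hu j).of_le (by simp)
  have hu1 : ContDiff ℝ 1 u := hu.of_le (by simp)
  have hW : ∀ j, ContDiff ℝ 1 fun y => (starRingEnd ℂ) (u y) * V j y := fun j =>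
    ((Complex.conjCLE : ℂ →L[ℝ] ℂ).contDiff.comp hu1).mul (hV j)
  have hWc : ∀ j, HasCompactSupport fun y => (starRingEnd ℂ) (u y) * V j y := fun j =>
    HasCompactSupport.intro hc fun x hx => by simp [image_eq_zero_of_notMem_tsupport hx]
  have hWi := fun j => (hW j).integrable_pd (hWc j) j
  have hWre : Integrable fun x =>
      (∑ j, pd j (fun y => (starRingEnd ℂ) (u y) * V j y) x).re :=
    (integrable_finsetSum Finset.univ fun j _ => hWi j).re
  have hW0 : ∫ x, (∑ j, pd j (fun y => (starRingEnd ℂ) (u y) * V j y) x).re = 0 := by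
    have h1 := Complex.reCLM.integral_comp_comm
      (integrable_finsetSum Finset.univ fun j _ => hWi j)
    rw [integral_finsetSum _ fun j _ => hWi j,
      Finset.sum_eq_zero fun j _ => integral_pd_eq_zero (hW j) (hWc j) j, map_zero] at h1
    exact h1
  have hG : Integrable fun x => ∑ j, ‖pd j u x‖ ^ 2 * sdet h x :=
    integrable_finsetSum _ fun j _ => integrable_norm_sq_pd_mul_sdet hs hp hu hc j
  have key := integral_mono (integrable_conj_mul_lapC hs hp hu hc).re
    (hWre.sub (hG.const_mul ν)) (fun x => by
      have hq := mul_le_mul_of_nonneg_right (hE.le_re_quadratic x fun j => pd j u x)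
        (Real.sqrt_nonneg (h x).det)
      have hdiv : ∑ j, pd j (fun y => (starRingEnd ℂ) (u y) * V j y) x =
          (starRingEnd ℂ) (u x) * (lapC h u x * ((sdet h x : ℝ) : ℂ)) +
            (∑ j, (starRingEnd ℂ) (pd j u x) * ∑ k, (((h x)⁻¹ j k : ℝ) : ℂ) * pd k u x)
              * ((sdet h x : ℝ) : ℂ) := by
        rw [lapC_mul_sdet hp, Finset.mul_sum, Finset.sum_mul, ← Finset.sum_add_distrib]
        refine Finset.sum_congr rfl fun j _ => ?_
        rw [pd_conj_mul (hu1.differentiable (by simp) x) ((hV j).differentiable (by simp) x)]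
        simp only [V]
        ring
      change _ ≤ (∑ j, pd j (fun y => (starRingEnd ℂ) (u y) * V j y) x).re
        - ν * ∑ j, ‖pd j u x‖ ^ 2 * sdet h x
      rw [hdiv, Complex.add_re, Complex.re_mul_ofReal, ← Finset.sum_mul]
      change _ * sdet h x ≤ _ * sdet h x at hq
      change Complex.re _ ≤ _
      linarith)
  have hsplit := integral_sub hWre (hG.const_mul ν)
  rw [hW0, integral_const_mul, zero_sub] at hsplit
  exact key.trans hsplit.le

section DiracOperator

variable {A : Fin 3 → Eu 3 → Fin 4 → Fin 4 → ℂ} {B : Eu 3 → Fin 4 → Fin 4 → ℂ}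
  {f : Eu 3 → Fin 4 → ℂ}

lemma ContDiff.hop (hA : ∀ j i k, ContDiff ℝ (⊤ : ℕ∞) fun x => A j x i k)
    (hB : ∀ i k, ContDiff ℝ (⊤ : ℕ∞) fun x => B x i k) (hf : ContDiff ℝ (⊤ : ℕ∞) f) :
    ContDiff ℝ (⊤ : ℕ∞) (Hop A B f) := by
  refine contDiff_pi.2 fun i => ?_
  exact (ContDiff.sum fun j _ => ContDiff.sum fun k _ =>
    (hA j i k).mul (contDiff_pi.1 (hf.pd (by simp) j) k)).add
    (ContDiff.sum fun k _ => (hB i k).mul (contDiff_pi.1 hf k))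

lemma HasCompactSupport.hop (hc : HasCompactSupport f) : HasCompactSupport (Hop A B f) :=
  HasCompactSupport.intro hc fun x hx => by
    funext i
    simp [Hop, pd_of_notMem_tsupport hx, image_eq_zero_of_notMem_tsupport hx]

lemma innC4_self_re (h : Eu 3 → Matrix (Fin 3) (Fin 3) ℝ) (g : Eu 3 → Fin 4 → ℂ) :
    (innC4 h g g).re = ∫ x, (∑ i, ‖g x i‖ ^ 2) * sdet h x := by
  have : innC4 h g g = ((∫ x, (∑ i, ‖g x i‖ ^ 2) * sdet h x : ℝ) : ℂ) := by
    rw [innC4, ← integral_complex_ofReal]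
    congr 1
    funext x
    push_cast
    simp only [Complex.conj_mul']
  rw [this, Complex.ofReal_re]

lemma HasCompactSupport.component (hc : HasCompactSupport f) (i : Fin 4) :
    HasCompactSupport fun x => f x i :=
  HasCompactSupport.intro hc fun x hx => by simp [image_eq_zero_of_notMem_tsupport hx]

end DiracOperator

lemma jap_rpow_mul_inv_norm_le {n : ℕ} {x : Eu n} (hx : x ≠ 0) {σ : ℝ} (hσ : 0 ≤ σ) :
    jap x ^ (-(1 + σ)) * ‖x‖⁻¹ ≤ (‖x‖ ^ 2)⁻¹ := by
  have hx0 : 0 < ‖x‖ := norm_pos_iff.2 hx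
  have h1 : 1 ≤ jap x := Real.one_le_sqrt.2 (by nlinarith)
  have h2 : ‖x‖ ≤ jap x := Real.le_sqrt_of_sq_le (by linarith)
  have h3 : jap x ^ (-(1 + σ)) ≤ ‖x‖⁻¹ := calc
    jap x ^ (-(1 + σ)) ≤ jap x ^ (-1 : ℝ) :=
      Real.rpow_le_rpow_of_exponent_le h1 (by linarith)
    _ = (jap x)⁻¹ := Real.rpow_neg_one _
    _ ≤ ‖x‖⁻¹ := inv_anti₀ hx0 h2
  calc jap x ^ (-(1 + σ)) * ‖x‖⁻¹ ≤ ‖x‖⁻¹ * ‖x‖⁻¹ := by gcongr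
    _ = (‖x‖ ^ 2)⁻¹ := by rw [sq, mul_inv]

section Weighted

variable {h : Eu 3 → Matrix (Fin 3) (Fin 3) ℝ} {u : Eu 3 → ℂ} {ν N : ℝ}

lemma Elliptic.integrable_hardy (hν : 0 < ν) (hE : Elliptic h ν N)
    (hs : ∀ i j, ContDiff ℝ (⊤ : ℕ∞) fun x => h x i j) (hp : ∀ x, (h x).PosDef)
    (hu : ContDiff ℝ 1 u) (hc : HasCompactSupport u) :
    Integrable fun x => ‖u x‖ ^ 2 * (‖x‖ ^ 2)⁻¹ * sdet h x :=
  (_root_.integrable_hardy hu hc).mul_bdd (c := √((ν ^ 3)⁻¹))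
    (contDiff_sdet hs hp).continuous.aestronglyMeasurable (ae_of_all _ fun x => by
      rw [sdet, Real.norm_of_nonneg (Real.sqrt_nonneg _)]
      exact (hE.sdet_bounds hν (hp x)).2)

/-- The Hardy inequality with respect to the volume of an elliptic metric. -/
lemma Elliptic.integral_hardy (hν : 0 < ν) (hE : Elliptic h ν N)
    (hs : ∀ i j, ContDiff ℝ (⊤ : ℕ∞) fun x => h x i j) (hp : ∀ x, (h x).PosDef)
    (hu : ContDiff ℝ (⊤ : ℕ∞) u) (hc : HasCompactSupport u) :
    √((N ^ 3)⁻¹) * ∫ x, ‖u x‖ ^ 2 * (‖x‖ ^ 2)⁻¹ * sdet h x ≤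
      4 * √((ν ^ 3)⁻¹) * ∫ x, ∑ j, ‖pd j u x‖ ^ 2 * sdet h x := by
  have hu1 : ContDiff ℝ 1 u := hu.of_le (by simp)
  have hG : Integrable fun x => ∑ j, ‖pd j u x‖ ^ 2 * sdet h x :=
    integrable_finsetSum _ fun j _ => integrable_norm_sq_pd_mul_sdet hs hp hu hc j
  have h1 : ∫ x, ‖u x‖ ^ 2 * (‖x‖ ^ 2)⁻¹ * sdet h x ≤
      (∫ x, ‖u x‖ ^ 2 * (‖x‖ ^ 2)⁻¹) * √((ν ^ 3)⁻¹) := by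
    rw [← integral_mul_const]
    refine integral_mono (hE.integrable_hardy hν hs hp hu1 hc)
      ((_root_.integrable_hardy hu1 hc).mul_const _) fun x => ?_
    exact mul_le_mul_of_nonneg_left (hE.sdet_bounds hν (hp x)).2 (by positivity)
  have h2 : √((N ^ 3)⁻¹) * ∫ x, ∑ j, ‖pd j u x‖ ^ 2 ≤
      ∫ x, ∑ j, ‖pd j u x‖ ^ 2 * sdet h x := by
    rw [← integral_const_mul]
    refine integral_mono ((integrable_finsetSum _ fun j _ =>
      hu1.integrable_norm_sq_pd hc j).const_mul _) hG fun x => ?_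
    change _ * _ ≤ ∑ j, ‖pd j u x‖ ^ 2 * sdet h x
    rw [← Finset.sum_mul, mul_comm]
    exact mul_le_mul_of_nonneg_left (hE.sdet_bounds hν (hp x)).1
      (Finset.sum_nonneg fun j _ => sq_nonneg _)
  have h3 := _root_.integral_hardy hu1 hc
  have ha := Real.sqrt_nonneg ((N ^ 3)⁻¹)
  have hb := Real.sqrt_nonneg ((ν ^ 3)⁻¹)
  calc _ ≤ √((N ^ 3)⁻¹) * ((4 * ∫ x, ∑ j, ‖pd j u x‖ ^ 2) * √((ν ^ 3)⁻¹)) := by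
        gcongr
        exact h1.trans (by gcongr)
    _ = 4 * √((ν ^ 3)⁻¹) * (√((N ^ 3)⁻¹) * ∫ x, ∑ j, ‖pd j u x‖ ^ 2) := by ring
    _ ≤ _ := by gcongr

end Weighted

/-- **Hardy-type estimate with gradient term** for the Dirac-type operator `H`
with `H² = m² − Δ_h + ¼R_h`. -/
theorem stmt6 (ν N : ℝ) (hν : 0 < ν) (hνN : ν ≤ N) :
    ∃ c > (0 : ℝ), ∃ c' > (0 : ℝ),
      ∀ h : Eu 3 → Matrix (Fin 3) (Fin 3) ℝ,
        (∀ j k : Fin 3, ContDiff ℝ (⊤ : ℕ∞) fun x => h x j k) →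
        (∀ x, (h x).IsSymm) → (∀ x, (h x).PosDef) →
        Elliptic h ν N →
        ∀ σ' CR : ℝ, σ' ∈ Set.Ioo (0 : ℝ) 1 → 0 ≤ CR →
          (∀ x : Eu 3, x ≠ 0 → |Rscal h x| ≤ CR * jap x ^ (-(1 + σ')) * ‖x‖⁻¹) →
          CR < c →
          ∀ ε : ℝ, ε ∈ Set.Ioo (0 : ℝ) 1 →
          ∀ m : ℝ, 0 ≤ m →
            ∀ (A : Fin 3 → Eu 3 → Fin 4 → Fin 4 → ℂ) (B : Eu 3 → Fin 4 → Fin 4 → ℂ),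
              (∀ j i k, ContDiff ℝ (⊤ : ℕ∞) fun x => A j x i k) →
              (∀ i k, ContDiff ℝ (⊤ : ℕ∞) fun x => B x i k) →
              (∀ f g : Eu 3 → Fin 4 → ℂ, ContDiff ℝ (⊤ : ℕ∞) f → ContDiff ℝ (⊤ : ℕ∞) g →
                HasCompactSupport f → HasCompactSupport g →
                innC4 h (Hop A B f) g = innC4 h f (Hop A B g)) →
              (∀ f : Eu 3 → Fin 4 → ℂ, ContDiff ℝ (⊤ : ℕ∞) f → ∀ (x : Eu 3) (i : Fin 4),
                Hop A B (Hop A B f) x i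
                  = ((m : ℂ) ^ 2) * f x i - lapC h (fun y => f y i) x
                    + ((Rscal h x / 4 : ℝ) : ℂ) * f x i) →
              ∀ f : Eu 3 → Fin 4 → ℂ, ContDiff ℝ (⊤ : ℕ∞) f → HasCompactSupport f →
                m ^ 2 * (∫ x : Eu 3, (∑ i, ‖f x i‖ ^ 2) * sdet h x)
                    + ((1 - ε) * c - CR) *
                        (∫ x : Eu 3, (∑ i, ‖f x i‖ ^ 2) * (‖x‖ ^ 2)⁻¹ * sdet h x)
                    + ε * c' * ∫ x : Eu 3, (∑ j, ∑ i, ‖pd j (fun y => f y i) x‖ ^ 2) * sdet h x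
                  ≤ ∫ x : Eu 3, (∑ i, ‖Hop A B f x i‖ ^ 2) * sdet h x := by
  have ha : 0 < √((N ^ 3)⁻¹) := Real.sqrt_pos.2 (by have := hν.trans_le hνN; positivity)
  have hb : 0 < √((ν ^ 3)⁻¹) := Real.sqrt_pos.2 (by positivity)
  refine ⟨ν * (√((N ^ 3)⁻¹) / (4 * √((ν ^ 3)⁻¹))), by positivity, ν, hν, ?_⟩
  intro h hs _ hp hE σ' CR hσ hCR hR _ ε hε m _ A B hA hB hsymm hsq f hf hc
  have hu : ∀ i, ContDiff ℝ (⊤ : ℕ∞) fun x => f x i := contDiff_pi.1 hf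
  have huc := hc.component
  have hD : ∀ x, 0 ≤ sdet h x := fun x => Real.sqrt_nonneg _
  have hDc : Continuous (sdet h) := (contDiff_sdet hs hp).continuous
  have hHf := hf.hop hA hB
  have hHHf := hHf.hop hA hB
  have hTi : Integrable fun x =>
      (∑ i, (starRingEnd ℂ) (f x i) * Hop A B (Hop A B f) x i) * ((sdet h x : ℝ) : ℂ) := by
    refine Continuous.integrable_of_hasCompactSupport ?_ ?_
    · exact (continuous_finsetSum _ fun i _ =>
        (Complex.continuous_conj.comp (hu i).continuous).mul
          (contDiff_pi.1 hHHf i).continuous).mul (Complex.continuous_ofReal.comp hDc)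
    · exact HasCompactSupport.intro hc fun x hx => by simp [image_eq_zero_of_notMem_tsupport hx]
  have hET : ∫ x, (∑ i, ‖Hop A B f x i‖ ^ 2) * sdet h x = ∫ x,
      ((∑ i, (starRingEnd ℂ) (f x i) * Hop A B (Hop A B f) x i) * ((sdet h x : ℝ) : ℂ)).re := by
    rw [← innC4_self_re, hsymm f _ hf hHf hc hc.hop]
    exact (Complex.reCLM.integral_comp_comm hTi).symm
  have hLi : ∀ i, Integrable fun x => ((starRingEnd ℂ) (f x i) *
      (lapC h (fun y => f y i) x * ((sdet h x : ℝ) : ℂ))).re := fun i =>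
    (integrable_conj_mul_lapC hs hp (hu i) (huc i)).re
  have hTre : Integrable fun x =>
      ((∑ i, (starRingEnd ℂ) (f x i) * Hop A B (Hop A B f) x i) * ((sdet h x : ℝ) : ℂ)).re :=
    hTi.re
  have hMi : Integrable fun x => (∑ i, ‖f x i‖ ^ 2) * sdet h x := by
    refine Continuous.integrable_of_hasCompactSupport ?_ ?_
    · exact (continuous_finsetSum _ fun i _ => (hu i).continuous.norm.pow 2).mul hDc
    · exact HasCompactSupport.intro hc fun x hx => by simp [image_eq_zero_of_notMem_tsupport hx]
  have hKi := fun i => hE.integrable_hardy hν hs hp ((hu i).of_le (by simp)) (huc i)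
  have hK : ∫ x, (∑ i, ‖f x i‖ ^ 2) * (‖x‖ ^ 2)⁻¹ * sdet h x =
      ∑ i, ∫ x, ‖f x i‖ ^ 2 * (‖x‖ ^ 2)⁻¹ * sdet h x := by
    rw [← integral_finsetSum _ fun i _ => hKi i]
    simp only [Finset.sum_mul]
  have hKint : Integrable fun x => (∑ i, ‖f x i‖ ^ 2) * (‖x‖ ^ 2)⁻¹ * sdet h x := by
    simpa only [Finset.sum_mul] using integrable_finsetSum Finset.univ fun i _ => hKi i
  have hG : ∫ x, (∑ j, ∑ i, ‖pd j (fun y => f y i) x‖ ^ 2) * sdet h x =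
      ∑ i, ∫ x, ∑ j, ‖pd j (fun y => f y i) x‖ ^ 2 * sdet h x := by
    rw [← integral_finsetSum _ fun i _ => integrable_finsetSum _ fun j _ =>
      integrable_norm_sq_pd_mul_sdet hs hp (hu i) (huc i) j]
    congr 1
    funext x
    rw [Finset.sum_comm]
    simp only [Finset.sum_mul]
  have hlap := Finset.sum_le_sum fun i (_ : i ∈ Finset.univ) =>
    hE.integral_lapC_le hs hp (hu i) (huc i)
  rw [Finset.sum_neg_distrib, ← Finset.mul_sum, ← hG,
    ← integral_finsetSum _ fun i _ => hLi i] at hlap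
  have hhardy := Finset.sum_le_sum fun i (_ : i ∈ Finset.univ) =>
    hE.integral_hardy hν hs hp (hu i) (huc i)
  rw [← Finset.mul_sum, ← Finset.mul_sum, ← hG, ← hK] at hhardy
  have hlower : m ^ 2 * (∫ x, (∑ i, ‖f x i‖ ^ 2) * sdet h x)
      - CR / 4 * (∫ x, (∑ i, ‖f x i‖ ^ 2) * (‖x‖ ^ 2)⁻¹ * sdet h x) ≤
      (∫ x, (∑ i, ‖Hop A B f x i‖ ^ 2) * sdet h x) + ∫ x, ∑ i, ((starRingEnd ℂ) (f x i) *
        (lapC h (fun y => f y i) x * ((sdet h x : ℝ) : ℂ))).re := by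
    have hLsum := integrable_finsetSum Finset.univ fun i _ => hLi i
    rw [hET, ← integral_const_mul, ← integral_const_mul,
      ← integral_sub (hMi.const_mul _) (hKint.const_mul _), ← integral_add hTre hLsum]
    refine integral_mono_ae ((hMi.const_mul _).sub (hKint.const_mul _)) (hTre.add hLsum) ?_
    filter_upwards [Measure.ae_ne volume (0 : Eu 3)] with x hx
    have hRx : -(CR * (‖x‖ ^ 2)⁻¹) ≤ Rscal h x := by
      refine (abs_le.1 ((hR x hx).trans ?_)).1
      rw [mul_assoc]
      exact mul_le_mul_of_nonneg_left (jap_rpow_mul_inv_norm_le hx hσ.1.le) hCR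
    have hpt : ((∑ i, (starRingEnd ℂ) (f x i) * Hop A B (Hop A B f) x i)
          * ((sdet h x : ℝ) : ℂ)).re
        + ∑ i, ((starRingEnd ℂ) (f x i) *
          (lapC h (fun y => f y i) x * ((sdet h x : ℝ) : ℂ))).re =
        (m ^ 2 + Rscal h x / 4) * ((∑ i, ‖f x i‖ ^ 2) * sdet h x) := by
      rw [← Complex.re_sum, ← Complex.add_re, ← Complex.ofReal_re (_ * _)]
      congr 1
      rw [Finset.sum_mul, ← Finset.sum_add_distrib]
      push_cast
      rw [Finset.sum_mul, Finset.mul_sum]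
      refine Finset.sum_congr rfl fun i _ => ?_
      rw [hsq f hf x i, ← Complex.conj_mul']
      push_cast
      ring
    refine le_of_le_of_eq ?_ hpt.symm
    have hn : 0 ≤ (∑ i, ‖f x i‖ ^ 2) * sdet h x :=
      mul_nonneg (Finset.sum_nonneg fun i _ => sq_nonneg _) (hD x)
    have := mul_le_mul_of_nonneg_right hRx hn
    change m ^ 2 * _ - CR / 4 * _ ≤ _
    linarith
  have hKnn : 0 ≤ ∫ x, (∑ i, ‖f x i‖ ^ 2) * (‖x‖ ^ 2)⁻¹ * sdet h x :=
    integral_nonneg fun x => mul_nonneg (mul_nonneg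
      (Finset.sum_nonneg fun i _ => sq_nonneg _) (by positivity)) (hD x)
  generalize (∫ x, (∑ i, ‖f x i‖ ^ 2) * (‖x‖ ^ 2)⁻¹ * sdet h x) = K at *
  generalize (∫ x, (∑ j, ∑ i, ‖pd j (fun y => f y i) x‖ ^ 2) * sdet h x) = G at *
  have hKG : √((N ^ 3)⁻¹) / (4 * √((ν ^ 3)⁻¹)) * K ≤ G := by
    rw [div_mul_eq_mul_div, div_le_iff₀ (by positivity)]
    linarith
  have h1 := mul_le_mul_of_nonneg_left hKG (mul_nonneg (sub_nonneg.2 hε.2.le) hν.le)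
  have h2 := mul_nonneg hCR hKnn
  linarith
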